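/- arXiv:2202.08998 — 3 statements merged into one kernel-verified Lean document; each statement's English description precedes it below -/
import Mathlib

section
/- Let p = (n₁, n₂, n₃) be an orthonormal frame of ℝ³. Then the nine 3×3 matrices V₁, V₂, V₃, W₁, W₂, W₃, W₄, W₅, W₆ associated with p are pairwise orthogonal for the Frobenius inner product, and their squared Frobenius norms are |V₁|² = |V₂|² = |V₃|² = |W₁|² = |W₂|² = |W₃|² = 2 and |W₄|² = |W₅|² = |W₆|² = 1; consequently these nine matrices form an orthogonal basis of the space of 3×3 real matrices. -/
open Matrix

noncomputable section

/-- Vectors of `ℝ³`. -/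
abbrev V3 : Type := Fin 3 → ℝ

/-- Frobenius inner product of `3 × 3` real matrices. -/
def frob (A B : Matrix (Fin 3) (Fin 3) ℝ) : ℝ := ∑ i, ∑ j, A i j * B i j

/-- The `3 × 3` matrix whose rows are the three given vectors. -/
def rowsOf (a b c : V3) : Matrix (Fin 3) (Fin 3) ℝ := Matrix.of ![a, b, c]

/-- `(n₁, n₂, n₃)` is an orthonormal frame of `ℝ³`. -/
def IsOrthoFrame (n₁ n₂ n₃ : V3) : Prop :=
  n₁ ⬝ᵥ n₁ = 1 ∧ n₂ ⬝ᵥ n₂ = 1 ∧ n₃ ⬝ᵥ n₃ = 1 ∧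
  n₁ ⬝ᵥ n₂ = 0 ∧ n₁ ⬝ᵥ n₃ = 0 ∧ n₂ ⬝ᵥ n₃ = 0

/-- The nine matrices `V₁, V₂, V₃, W₁, W₂, W₃, W₄, W₅, W₆` associated with a frame. -/
def frameBasis (n₁ n₂ n₃ : V3) : Fin 9 → Matrix (Fin 3) (Fin 3) ℝ :=
  ![rowsOf 0 n₃ (-n₂), rowsOf (-n₃) 0 n₁, rowsOf n₂ (-n₁) 0,
    rowsOf 0 n₃ n₂, rowsOf n₃ 0 n₁, rowsOf n₂ n₁ 0,
    rowsOf n₁ 0 0, rowsOf 0 n₂ 0, rowsOf 0 0 n₃]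

theorem frob_rowsOf (a b c d e f : V3) :
    frob (rowsOf a b c) (rowsOf d e f) = a ⬝ᵥ d + b ⬝ᵥ e + c ⬝ᵥ f := by
  simp [frob, rowsOf, dotProduct, Fin.sum_univ_three]

/-- The Frobenius product with a fixed matrix, as a linear map. -/
def frobLin (A : Matrix (Fin 3) (Fin 3) ℝ) : Matrix (Fin 3) (Fin 3) ℝ →ₗ[ℝ] ℝ where
  toFun B := frob A B
  map_add' B C := by simp [frob, mul_add, Finset.sum_add_distrib]
  map_smul' r B := by
    simp only [frob, Matrix.smul_apply, smul_eq_mul, RingHom.id_apply, Finset.mul_sum]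
    exact Finset.sum_congr rfl fun i _ => Finset.sum_congr rfl fun j _ => by ring

theorem statement0 (n₁ n₂ n₃ : V3) (h : IsOrthoFrame n₁ n₂ n₃) :
    (∀ k l : Fin 9, k ≠ l →
      frob (frameBasis n₁ n₂ n₃ k) (frameBasis n₁ n₂ n₃ l) = 0) ∧
    (∀ k : Fin 9, (k : ℕ) < 6 →
      frob (frameBasis n₁ n₂ n₃ k) (frameBasis n₁ n₂ n₃ k) = 2) ∧
    (∀ k : Fin 9, 6 ≤ (k : ℕ) →
      frob (frameBasis n₁ n₂ n₃ k) (frameBasis n₁ n₂ n₃ k) = 1) ∧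
    LinearIndependent ℝ (frameBasis n₁ n₂ n₃) ∧
    Submodule.span ℝ (Set.range (frameBasis n₁ n₂ n₃)) = ⊤ := by
  obtain ⟨h11, h22, h33, h12, h13, h23⟩ := h
  have h21 : n₂ ⬝ᵥ n₁ = 0 := by rw [dotProduct_comm, h12]
  have h31 : n₃ ⬝ᵥ n₁ = 0 := by rw [dotProduct_comm, h13]
  have h32 : n₃ ⬝ᵥ n₂ = 0 := by rw [dotProduct_comm, h23]
  have orth : ∀ k l : Fin 9, k ≠ l →
      frob (frameBasis n₁ n₂ n₃ k) (frameBasis n₁ n₂ n₃ l) = 0 := by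
    intro k l hkl
    fin_cases k <;> fin_cases l <;> first
      | exact absurd rfl hkl
      | simp [frameBasis, frob_rowsOf, h11, h22, h33, h12, h13, h23, h21, h31, h32]
  have n2 : ∀ k : Fin 9, (k : ℕ) < 6 →
      frob (frameBasis n₁ n₂ n₃ k) (frameBasis n₁ n₂ n₃ k) = 2 := by
    intro k hk
    fin_cases k <;> first
      | (exfalso; simp at hk; done)
      | (simp [frameBasis, frob_rowsOf, h11, h22, h33]; try norm_num)
  have n1 : ∀ k : Fin 9, 6 ≤ (k : ℕ) →
      frob (frameBasis n₁ n₂ n₃ k) (frameBasis n₁ n₂ n₃ k) = 1 := by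
    intro k hk
    fin_cases k <;> first
      | (exfalso; simp at hk; done)
      | simp [frameBasis, frob_rowsOf, h11, h22, h33]
  have li : LinearIndependent ℝ (frameBasis n₁ n₂ n₃) := by
    rw [Fintype.linearIndependent_iff]
    intro g hg k
    have h0 := congrArg (frobLin (frameBasis n₁ n₂ n₃ k)) hg
    rw [map_sum, map_zero, Finset.sum_eq_single k] at h0
    · rw [map_smul, smul_eq_mul] at h0
      change g k * frob (frameBasis n₁ n₂ n₃ k) (frameBasis n₁ n₂ n₃ k) = 0 at h0
      rcases lt_or_ge (k : ℕ) 6 with hk | hk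
      · rw [n2 k hk] at h0
        linarith
      · rw [n1 k hk] at h0
        linarith
    · intro l _ hl
      rw [map_smul, smul_eq_mul]
      change g l * frob (frameBasis n₁ n₂ n₃ k) (frameBasis n₁ n₂ n₃ l) = 0
      rw [orth k l hl.symm, mul_zero]
    · simp
  refine ⟨orth, n2, n1, li, ?_⟩
  apply li.span_eq_top_of_card_eq_finrank'
  simp [Module.finrank_matrix]
end
end

section
/- Let p be an orthonormal frame of ℝ³, let ε > 0, and let c = (c₁, c₂, c₃) : (−ε, ε) → (ℝ³)³ be differentiable with c(0) = p and with c(t) an orthonormal frame for every t ∈ (−ε, ε). Then the derivative c'(0), viewed as a 3×3 matrix, belongs to the linear span of the three matrices V₁(p), V₂(p), V₃(p) associated with p. (Thus the tangent space to the set of orthonormal frames at p is spanned by V₁, V₂, V₃.) -/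
open Matrix

noncomputable section

/-- The matrices `V₁, V₂, V₃` associated with a frame. -/
def Vmat (n₁ n₂ n₃ : V3) : Fin 3 → Matrix (Fin 3) (Fin 3) ℝ :=
  ![rowsOf 0 n₃ (-n₂), rowsOf (-n₃) 0 n₁, rowsOf n₂ (-n₁) 0]

theorem dot_deriv_aux (f g : ℝ → V3) (k ε : ℝ) (hε : 0 < ε)
    (hf : DifferentiableAt ℝ f 0) (hg : DifferentiableAt ℝ g 0)
    (hk : ∀ t ∈ Set.Ioo (-ε) ε, f t ⬝ᵥ g t = k) :
    deriv f 0 ⬝ᵥ g 0 + f 0 ⬝ᵥ deriv g 0 = 0 := by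
  have hf' := hasDerivAt_pi.1 hf.hasDerivAt
  have hg' := hasDerivAt_pi.1 hg.hasDerivAt
  have h1 : HasDerivAt (fun t => ∑ i, f t i * g t i)
      (∑ i, (deriv f 0 i * g 0 i + f 0 i * deriv g 0 i)) 0 :=
    HasDerivAt.fun_sum fun i _ => (hf' i).mul (hg' i)
  have h2 : HasDerivAt (fun t => ∑ i, f t i * g t i) 0 0 := by
    refine (hasDerivAt_const (0 : ℝ) k).congr_of_eventuallyEq ?_
    filter_upwards [Ioo_mem_nhds (neg_lt_zero.2 hε) hε] with t ht
    exact hk t ht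
  have h3 := h1.unique h2
  rw [Finset.sum_add_distrib] at h3
  exact h3

theorem frame_expand (n₁ n₂ n₃ : V3) (h : IsOrthoFrame n₁ n₂ n₃) (v : V3) :
    v = (v ⬝ᵥ n₁) • n₁ + (v ⬝ᵥ n₂) • n₂ + (v ⬝ᵥ n₃) • n₃ := by
  obtain ⟨h1, h2, h3, h4, h5, h6⟩ := h
  have hN : rowsOf n₁ n₂ n₃ * (rowsOf n₁ n₂ n₃)ᵀ = 1 := by
    ext i j
    have e : (rowsOf n₁ n₂ n₃ * (rowsOf n₁ n₂ n₃)ᵀ) i j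
        = (![n₁, n₂, n₃] i) ⬝ᵥ (![n₁, n₂, n₃] j) := rfl
    rw [e]
    fin_cases i <;> fin_cases j <;>
      simp [h1, h2, h3, h4, h5, h6, dotProduct_comm n₂ n₁, dotProduct_comm n₃ n₁,
        dotProduct_comm n₃ n₂]
  have hN' := mul_eq_one_comm.1 hN
  have hv : ((rowsOf n₁ n₂ n₃)ᵀ * rowsOf n₁ n₂ n₃) *ᵥ v = v := by rw [hN', one_mulVec]
  rw [← mulVec_mulVec] at hv
  ext k
  have := congrFun hv k
  simp [rowsOf, mulVec, dotProduct, Fin.sum_univ_three] at this ⊢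
  linarith

theorem statement4 (n₁ n₂ n₃ : V3) (h : IsOrthoFrame n₁ n₂ n₃)
    (ε : ℝ) (hε : 0 < ε) (c : Fin 3 → ℝ → V3)
    (hdiff : ∀ i : Fin 3, ∀ t ∈ Set.Ioo (-ε) ε, DifferentiableAt ℝ (c i) t)
    (hc0 : c 0 0 = n₁ ∧ c 1 0 = n₂ ∧ c 2 0 = n₃)
    (hframe : ∀ t ∈ Set.Ioo (-ε) ε, IsOrthoFrame (c 0 t) (c 1 t) (c 2 t)) :
    rowsOf (deriv (c 0) 0) (deriv (c 1) 0) (deriv (c 2) 0) ∈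
      Submodule.span ℝ (Set.range (Vmat n₁ n₂ n₃)) := by
  have h0 : (0 : ℝ) ∈ Set.Ioo (-ε) ε := ⟨neg_lt_zero.2 hε, hε⟩
  have D := fun i => hdiff i 0 h0
  have a11 := dot_deriv_aux _ _ 1 ε hε (D 0) (D 0) fun t ht => (hframe t ht).1
  have a22 := dot_deriv_aux _ _ 1 ε hε (D 1) (D 1) fun t ht => (hframe t ht).2.1
  have a33 := dot_deriv_aux _ _ 1 ε hε (D 2) (D 2) fun t ht => (hframe t ht).2.2.1
  have a12 := dot_deriv_aux _ _ 0 ε hε (D 0) (D 1) fun t ht => (hframe t ht).2.2.2.1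
  have a13 := dot_deriv_aux _ _ 0 ε hε (D 0) (D 2) fun t ht => (hframe t ht).2.2.2.2.1
  have a23 := dot_deriv_aux _ _ 0 ε hε (D 1) (D 2) fun t ht => (hframe t ht).2.2.2.2.2
  obtain ⟨c0, c1, c2⟩ := hc0
  rw [c0, dotProduct_comm n₁] at a11
  rw [c1, dotProduct_comm n₂] at a22
  rw [c2, dotProduct_comm n₃] at a33
  rw [c0, c1, dotProduct_comm n₁] at a12
  rw [c0, c2, dotProduct_comm n₁] at a13
  rw [c1, c2, dotProduct_comm n₂] at a23
  have e1 := frame_expand _ _ _ h (deriv (c 0) 0)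
  have e2 := frame_expand _ _ _ h (deriv (c 1) 0)
  have e3 := frame_expand _ _ _ h (deriv (c 2) 0)
  generalize deriv (c 0) 0 = d1 at *
  generalize deriv (c 1) 0 = d2 at *
  generalize deriv (c 2) 0 = d3 at *
  rw [show d1 ⬝ᵥ n₁ = 0 by linarith] at e1
  rw [show d2 ⬝ᵥ n₂ = 0 by linarith, show d2 ⬝ᵥ n₁ = -(d1 ⬝ᵥ n₂) by linarith] at e2
  rw [show d3 ⬝ᵥ n₃ = 0 by linarith, show d3 ⬝ᵥ n₁ = -(d1 ⬝ᵥ n₃) by linarith,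
    show d3 ⬝ᵥ n₂ = -(d2 ⬝ᵥ n₃) by linarith] at e3
  generalize d1 ⬝ᵥ n₂ = a at *
  generalize d1 ⬝ᵥ n₃ = b at *
  generalize d2 ⬝ᵥ n₃ = g at *
  rw [Submodule.mem_span_range_iff_exists_fun]
  refine ⟨![g, -b, a], ?_⟩
  rw [e1, e2, e3]
  ext i j
  fin_cases i <;> simp [Fin.sum_univ_three, Vmat, rowsOf] <;> ring
end
end

section
/- Let n : ℝ³ → ℝ³ be twice continuously differentiable with |n(x)| = 1 for every x ∈ ℝ³. Then at every point of ℝ³: |∇n|² = (div n)² + (n · curl n)² + |n × curl n|² + div((n·∇)n − (div n) n), where (n·∇)n denotes the vector field with components Σ_j n^j ∂_j n^i. -/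
open Matrix

noncomputable section

/-- The partial derivative `∂ⱼ f` at `x` of a scalar function on `ℝ³`. -/
def pd (j : Fin 3) (f : (Fin 3 → ℝ) → ℝ) (x : Fin 3 → ℝ) : ℝ :=
  fderiv ℝ f x (Pi.single j 1)

/-- The divergence of a vector field on `ℝ³`. -/
def vdiv (F : (Fin 3 → ℝ) → V3) (x : Fin 3 → ℝ) : ℝ :=
  ∑ i, pd i (fun y => F y i) x

/-- The curl of a vector field on `ℝ³`. -/
def vcurl (F : (Fin 3 → ℝ) → V3) (x : Fin 3 → ℝ) : V3 :=
  ![pd 1 (fun y => F y 2) x - pd 2 (fun y => F y 1) x,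
    pd 2 (fun y => F y 0) x - pd 0 (fun y => F y 2) x,
    pd 0 (fun y => F y 1) x - pd 1 (fun y => F y 0) x]

/-- `|∇F|² = Σ_{i,j} (∂ⱼ Fⁱ)²` for a vector field on `ℝ³`. -/
def gradNormSq (F : (Fin 3 → ℝ) → V3) (x : Fin 3 → ℝ) : ℝ :=
  ∑ i, ∑ j, (pd j (fun y => F y i) x) ^ 2

/-- The convective term `(F·∇)F`, with components `Σ_j F^j ∂_j F^i`. -/
def convect (F : (Fin 3 → ℝ) → V3) (x : Fin 3 → ℝ) : V3 :=
  fun i => ∑ j, F x j * pd j (fun y => F y i) x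

theorem pd_hasFDerivAt {f : (Fin 3 → ℝ) → ℝ} (hf : ContDiff ℝ 2 f) (j : Fin 3) (x : Fin 3 → ℝ) :
    DifferentiableAt ℝ (pd j f) x := by
  have h1 : ContDiff ℝ 1 (fderiv ℝ f) := hf.fderiv_right (by norm_num)
  have h2 : Differentiable ℝ (fderiv ℝ f) := h1.differentiable (by norm_num)
  exact (h2 x).clm_apply (differentiableAt_const _)

theorem pd_comm {f : (Fin 3 → ℝ) → ℝ} (hf : ContDiff ℝ 2 f) (i j : Fin 3) (x : Fin 3 → ℝ) :
    pd i (pd j f) x = pd j (pd i f) x := by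
  have h1 : ContDiff ℝ 1 (fderiv ℝ f) := hf.fderiv_right (by norm_num)
  have h2 : Differentiable ℝ (fderiv ℝ f) := h1.differentiable (by norm_num)
  have key : ∀ a b : Fin 3, pd a (pd b f) x
      = fderiv ℝ (fderiv ℝ f) x (Pi.single a 1) (Pi.single b 1) := by
    intro a b
    have h3 : HasFDerivAt (pd b f) _ x :=
      (h2 x).hasFDerivAt.clm_apply (hasFDerivAt_const (Pi.single b 1 : Fin 3 → ℝ) x)
    unfold pd at h3 ⊢
    rw [h3.fderiv]
    simp
  rw [key, key]
  exact (hf.contDiffAt.isSymmSndFDerivAt (by simp)) _ _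

theorem pd_add {f g : (Fin 3 → ℝ) → ℝ} {x : Fin 3 → ℝ} (i : Fin 3)
    (hf : DifferentiableAt ℝ f x) (hg : DifferentiableAt ℝ g x) :
    pd i (fun y => f y + g y) x = pd i f x + pd i g x := by
  unfold pd
  rw [fderiv_fun_add hf hg]; rfl

theorem pd_sub {f g : (Fin 3 → ℝ) → ℝ} {x : Fin 3 → ℝ} (i : Fin 3)
    (hf : DifferentiableAt ℝ f x) (hg : DifferentiableAt ℝ g x) :
    pd i (fun y => f y - g y) x = pd i f x - pd i g x := by
  unfold pd
  rw [fderiv_fun_sub hf hg]; rfl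

theorem pd_mul {f g : (Fin 3 → ℝ) → ℝ} {x : Fin 3 → ℝ} (i : Fin 3)
    (hf : DifferentiableAt ℝ f x) (hg : DifferentiableAt ℝ g x) :
    pd i (fun y => f y * g y) x = pd i f x * g x + f x * pd i g x := by
  unfold pd
  rw [fderiv_fun_mul hf hg]; simp; ring

theorem statement6 (n : (Fin 3 → ℝ) → V3) (hn : ContDiff ℝ 2 n)
    (hunit : ∀ x, n x ⬝ᵥ n x = 1) :
    ∀ x, gradNormSq n x
      = (vdiv n x) ^ 2 + (n x ⬝ᵥ vcurl n x) ^ 2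
        + (crossProduct (n x) (vcurl n x)) ⬝ᵥ (crossProduct (n x) (vcurl n x))
        + vdiv (fun y => convect n y - vdiv n y • n y) x := by
  intro x
  have hc : ∀ i, ContDiff ℝ 2 (fun y => n y i) := fun i => contDiff_pi.1 hn i
  have hd : ∀ i, DifferentiableAt ℝ (fun y => n y i) x :=
    fun i => ((hc i).differentiable (by norm_num)) x
  have hp : ∀ i j, DifferentiableAt ℝ (fun y => pd j (fun z => n z i) y) x :=
    fun i j => pd_hasFDerivAt (hc i) j x
  have hu := hunit x
  have hm : ∀ i j k, DifferentiableAt ℝ (fun y => n y k * pd j (fun z => n z i) y) x :=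
    fun i j k => (hd k).fun_mul (hp i j)
  have hcomp : ∀ i, pd i (fun y => (convect n y - vdiv n y • n y) i) x
      = (∑ j, (pd i (fun y => n y j) x * pd j (fun y => n y i) x
          + n x j * pd i (pd j (fun y => n y i)) x))
        - ((∑ j, pd i (pd j (fun y => n y j)) x) * n x i
          + (∑ j, pd j (fun y => n y j) x) * pd i (fun y => n y i) x) := by
    intro i
    simp only [Pi.sub_apply, Pi.smul_apply, smul_eq_mul, convect, vdiv, Fin.sum_univ_three]
    rw [pd_sub i (((hm _ _ _).fun_add (hm _ _ _)).fun_add (hm _ _ _))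
        ((((hp _ _).fun_add (hp _ _)).fun_add (hp _ _)).fun_mul (hd _)),
      pd_add i ((hm _ _ _).fun_add (hm _ _ _)) (hm _ _ _), pd_add i (hm _ _ _) (hm _ _ _),
      pd_mul i (hd _) (hp _ _), pd_mul i (hd _) (hp _ _), pd_mul i (hd _) (hp _ _),
      pd_mul i (((hp _ _).fun_add (hp _ _)).fun_add (hp _ _)) (hd _),
      pd_add i ((hp _ _).fun_add (hp _ _)) (hp _ _), pd_add i (hp _ _) (hp _ _)]
  have e : vdiv (fun y => convect n y - vdiv n y • n y) x
      = ∑ i, pd i (fun y => (convect n y - vdiv n y • n y) i) x := rfl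
  rw [e]
  simp only [hcomp]
  simp only [gradNormSq, vdiv, vcurl, cross_apply, dotProduct, Fin.sum_univ_three,
    Matrix.cons_val] at hu ⊢
  rw [pd_comm (hc 0) 1 0, pd_comm (hc 0) 2 0, pd_comm (hc 1) 2 1, pd_comm (hc 1) 0 1,
    pd_comm (hc 2) 0 2, pd_comm (hc 2) 1 2]
  generalize pd 0 (fun y => n y 0) x = a00
  generalize pd 0 (fun y => n y 1) x = a01
  generalize pd 0 (fun y => n y 2) x = a02
  generalize pd 1 (fun y => n y 0) x = a10
  generalize pd 1 (fun y => n y 1) x = a11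
  generalize pd 1 (fun y => n y 2) x = a12
  generalize pd 2 (fun y => n y 0) x = a20
  generalize pd 2 (fun y => n y 1) x = a21
  generalize pd 2 (fun y => n y 2) x = a22
  linear_combination (-((a12 - a21) ^ 2 + (a20 - a02) ^ 2 + (a01 - a10) ^ 2)) * hu
end
end
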